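/- Let α > 0 be real. Then: (i) ∫_0^∞ e^{−x} x^{α−1} K_0(x) dx = √π Γ(α)² / (2^α Γ(α+1/2)); (ii) for every n ≥ 1, ∫_0^∞ P_n(x;α) e^{−x} x^{α−1} K_0(x) dx = 0; and (iii) for every real polynomial g that is nonnegative on (0,∞) and not identically zero, ∫_0^∞ g(x) e^{−x} x^{α−1} K_0(x) dx > 0. Consequently, the canonical dual functional u_0(α) admits the positive-definite integral representation u_0(α)(f) = (2^α Γ(α+1/2)/(√π Γ(α)²)) ∫_0^∞ f(x) e^{−x} x^{α−1} K_0(x) dx for all f ∈ ℝ[x]. -/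

import Mathlib

open Polynomial MeasureTheory

/-- The polynomials `p_n(x; α)` (real version) defined recursively by
`p_0 = 1`, `p_{n+1} = x² p_n'' − x(2x − 1 − 2α) p_n' − ((2α+1)x − α²) p_n`. -/
noncomputable def pseqR (α : ℝ) : ℕ → ℝ[X]
  | 0 => 1
  | n + 1 =>
      X ^ 2 * derivative (derivative (pseqR α n))
        - X * (2 * X - C (1 + 2 * α)) * derivative (pseqR α n)
        - (C (2 * α + 1) * X - C (α ^ 2)) * pseqR α n

/-- The monic normalization `P_n(x;α) = p_n(x;α) / ((−2)ⁿ (α+1/2)_n)`. -/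
noncomputable def PmonicR (α : ℝ) (n : ℕ) : ℝ[X] :=
  ((-2 : ℝ) ^ n * (ascPochhammer ℝ n).eval (α + 1 / 2))⁻¹ • pseqR α n

/-- The modified Bessel function of the third kind of order zero,
`K₀(x) = ∫₀^∞ e^{−x cosh u} du`. -/
noncomputable def K0 (x : ℝ) : ℝ :=
  ∫ u in Set.Ioi (0 : ℝ), Real.exp (-x * Real.cosh u)

/-- The raising operator of the sequence `pseqR`, as a linear map. -/
noncomputable def raisingOp (α : ℝ) : ℝ[X] →ₗ[ℝ] ℝ[X] :=
  LinearMap.mulLeft ℝ (X ^ 2) ∘ₗ derivative ∘ₗ derivative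
    - LinearMap.mulLeft ℝ (X * (2 * X - C (1 + 2 * α))) ∘ₗ derivative
    - LinearMap.mulLeft ℝ (C (2 * α + 1) * X - C (α ^ 2))

theorem pseqR_succ (α : ℝ) (n : ℕ) : pseqR α (n + 1) = raisingOp α (pseqR α n) := by
  simp [pseqR, raisingOp, mul_assoc]

theorem raisingOp_X_pow (α : ℝ) (k : ℕ) :
    raisingOp α (X ^ k) =
      C ((α + k) ^ 2) * X ^ k - C (2 * (α + k) + 1) * X ^ (k + 1) := by
  rcases k with _ | _ | k
  · simp [raisingOp]
  · simp [raisingOp, C_ofNat]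
    ring
  · simp [raisingOp, C_ofNat]
    ring

theorem coeff_raisingOp_succ (α : ℝ) (q : ℝ[X]) (n : ℕ) :
    (raisingOp α q).coeff (n + 1) =
      (α + (n + 1)) ^ 2 * q.coeff (n + 1) - (2 * (α + n) + 1) * q.coeff n := by
  induction q using Polynomial.induction_on' with
  | add p q hp hq => simp only [map_add, coeff_add, hp, hq]; ring
  | monomial k a =>
    rw [← C_mul_X_pow_eq_monomial, ← smul_eq_C_mul, map_smul, raisingOp_X_pow]
    simp only [coeff_smul, coeff_sub, coeff_C_mul, coeff_X_pow, smul_eq_mul]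
    by_cases h : n = k
    · subst h; simp; ring
    · by_cases h' : n + 1 = k
      · subst h'; simp; ring
      · simp [h, h']

theorem degree_pseqR {α : ℝ} (hα : 0 < α) (n : ℕ) : (pseqR α n).degree = n := by
  induction n with
  | zero => simp [pseqR]
  | succ n ih =>
    have hzero (m : ℕ) (hm : n < m) : (pseqR α n).coeff m = 0 :=
      coeff_eq_zero_of_degree_lt (by rw [ih]; exact_mod_cast hm)
    rw [pseqR_succ]
    refine degree_eq_of_le_of_coeff_ne_zero ((degree_le_iff_coeff_zero _ _).2 fun m hm => ?_) ?_
    · have hm : n + 1 < m := by exact_mod_cast hm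
      obtain ⟨m, rfl⟩ := Nat.exists_eq_add_one_of_ne_zero (by omega : m ≠ 0)
      simp [coeff_raisingOp_succ, hzero m (by omega), hzero (m + 1) (by omega)]
    · rw [coeff_raisingOp_succ, hzero _ n.lt_succ_self, mul_zero, zero_sub, neg_ne_zero]
      exact mul_ne_zero (by positivity) (coeff_ne_zero_of_eq_degree ih)

theorem degree_PmonicR {α : ℝ} (hα : 0 < α) (n : ℕ) : (PmonicR α n).degree = n := by
  have h : (ascPochhammer ℝ n).eval (α + 1 / 2) ≠ 0 := (ascPochhammer_pos n _ (by positivity)).ne'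
  have h2 : (-2 : ℝ) ^ n ≠ 0 := pow_ne_zero _ (by norm_num)
  rw [PmonicR, smul_eq_C_mul, degree_C_mul (inv_ne_zero (mul_ne_zero h2 h)),
    degree_pseqR hα]

theorem linearMap_ext_PmonicR {α : ℝ} (hα : 0 < α) {u v : ℝ[X] →ₗ[ℝ] ℝ}
    (h : ∀ n, u (PmonicR α n) = v (PmonicR α n)) : u = v := by
  let S : Polynomial.Sequence ℝ := ⟨PmonicR α, degree_PmonicR hα⟩
  exact LinearMap.ext_on_range
    (S.span fun i => (leadingCoeff_ne_zero.2 (S.ne_zero i)).isUnit) h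

/-- The real Beta integral in terms of the Gamma function. -/
theorem integral_Ioo_rpow_mul_one_sub_rpow {a b : ℝ} (ha : 0 < a) (hb : 0 < b) :
    ∫ t in Set.Ioo (0 : ℝ) 1, t ^ (a - 1) * (1 - t) ^ (b - 1) =
      Real.Gamma a * Real.Gamma b / Real.Gamma (a + b) := by
  have h := ProbabilityTheory.beta_eq_betaIntegralReal a b ha hb
  rw [ProbabilityTheory.beta] at h
  rw [h, Complex.betaIntegral, intervalIntegral.integral_of_le zero_le_one,
    ← integral_Ioc_eq_integral_Ioo, ← Complex.ofReal_re (∫ _ in _, _), ← integral_complex_ofReal]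
  congr 1
  refine setIntegral_congr_fun measurableSet_Ioc fun x ⟨hx, hx'⟩ => ?_
  simp only [Complex.ofReal_mul, Complex.ofReal_cpow hx.le, Complex.ofReal_cpow (sub_nonneg.2 hx')]
  simp

theorem image_two_div_one_add_cosh :
    (fun u => 2 / (1 + Real.cosh u)) '' Set.Ioi (0 : ℝ) = Set.Ioo 0 1 := by
  ext t
  constructor
  · rintro ⟨u, hu, rfl⟩
    have h : 1 < Real.cosh u := Real.one_lt_cosh.2 (ne_of_gt hu)
    exact ⟨by positivity, by rw [div_lt_one] <;> linarith⟩
  · rintro ⟨h0, h1⟩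
    have h : 1 < 2 / t - 1 := by
      rw [lt_sub_iff_add_lt, lt_div_iff₀ h0]
      linarith
    refine ⟨Real.arcosh (2 / t - 1), Real.arcosh_pos h, ?_⟩
    simp only [Real.cosh_arcosh h.le]
    field_simp
    ring

theorem injOn_two_div_one_add_cosh :
    Set.InjOn (fun u => 2 / (1 + Real.cosh u)) (Set.Ioi (0 : ℝ)) := by
  intro u hu v hv h
  have hu' := Real.cosh_pos u
  have hv' := Real.cosh_pos v
  refine Real.cosh_injOn (Set.mem_Ici.2 (le_of_lt hu)) (Set.mem_Ici.2 (le_of_lt hv)) ?_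
  simp only at h
  field_simp at h
  linarith

theorem integral_one_add_cosh_rpow_neg {s : ℝ} (hs : 0 < s) :
    ∫ u in Set.Ioi (0 : ℝ), (1 + Real.cosh u) ^ (-s) =
      Real.sqrt Real.pi * Real.Gamma s / (2 ^ s * Real.Gamma (s + 1 / 2)) := by
  have hderiv (u : ℝ) (_ : u ∈ Set.Ioi (0 : ℝ)) :
      HasDerivWithinAt (fun u => 2 / (1 + Real.cosh u))
        (-(2 * Real.sinh u) / (1 + Real.cosh u) ^ 2) (Set.Ioi 0) u := by
    have h := ((hasDerivAt_const u (2 : ℝ)).fun_div ((Real.hasDerivAt_cosh u).const_add 1)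
      (by have := Real.cosh_pos u; positivity)).hasDerivWithinAt (s := Set.Ioi 0)
    simpa using h
  have hchange := integral_image_eq_integral_abs_deriv_smul measurableSet_Ioi hderiv
    injOn_two_div_one_add_cosh fun t : ℝ => t ^ (s - 1) * (1 - t) ^ ((1 / 2 : ℝ) - 1)
  rw [image_two_div_one_add_cosh, integral_Ioo_rpow_mul_one_sub_rpow hs (by norm_num),
    Real.Gamma_one_half_eq] at hchange
  have hpoint : ∀ u ∈ Set.Ioi (0 : ℝ),
      |-(2 * Real.sinh u) / (1 + Real.cosh u) ^ 2| • ((2 / (1 + Real.cosh u)) ^ (s - 1) *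
        (1 - 2 / (1 + Real.cosh u)) ^ ((1 / 2 : ℝ) - 1)) =
      2 ^ s * (1 + Real.cosh u) ^ (-s) := by
    intro u hu
    have hS : 0 < Real.sinh u := Real.sinh_pos_iff.2 hu
    have hc := Real.cosh_pos u
    have hC : 0 < 1 + Real.cosh u := by positivity
    have hsq : 1 - 2 / (1 + Real.cosh u) = (Real.sinh u / (1 + Real.cosh u)) ^ (2 : ℝ) := by
      rw [Real.rpow_two, div_pow, Real.sinh_sq]
      field_simp
      ring
    rw [hsq, ← Real.rpow_mul (by positivity), neg_div, abs_neg, abs_of_pos (by positivity),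
      Real.div_rpow two_pos.le hC.le, Real.rpow_sub_one two_ne_zero, Real.rpow_sub_one hC.ne',
      Real.rpow_neg hC.le, show (2 : ℝ) * (1 / 2 - 1) = -1 by norm_num, Real.rpow_neg_one,
      smul_eq_mul]
    have := Real.rpow_pos_of_pos hC s
    field_simp
  rw [setIntegral_congr_fun measurableSet_Ioi hpoint, integral_const_mul] at hchange
  rw [mul_comm (Real.sqrt _), ← div_div, div_right_comm, hchange, mul_div_cancel_left₀]
  positivity

theorem integrableOn_one_add_cosh_rpow_neg {s : ℝ} (hs : 0 < s) :
    IntegrableOn (fun u => (1 + Real.cosh u) ^ (-s)) (Set.Ioi 0) := by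
  refine .of_integral_ne_zero ?_
  rw [integral_one_add_cosh_rpow_neg hs]
  have := Real.Gamma_pos_of_pos hs
  have := Real.Gamma_pos_of_pos (show 0 < s + 1 / 2 by positivity)
  positivity

theorem exp_mul_rpow_mul_exp_cosh (s x u : ℝ) :
    Real.exp (-x) * x ^ (s - 1) * Real.exp (-x * Real.cosh u) =
      x ^ (s - 1) * Real.exp (-((1 + Real.cosh u) * x)) := by
  rw [mul_right_comm, ← Real.exp_add, mul_comm]
  ring_nf

theorem integral_exp_mul_rpow_mul_exp_cosh {s : ℝ} (hs : 0 < s) (u : ℝ) :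
    ∫ x in Set.Ioi (0 : ℝ), Real.exp (-x) * x ^ (s - 1) * Real.exp (-x * Real.cosh u) =
      Real.Gamma s * (1 + Real.cosh u) ^ (-s) := by
  have hC : 0 < 1 + Real.cosh u := by have := Real.cosh_pos u; positivity
  simp_rw [exp_mul_rpow_mul_exp_cosh]
  rw [Real.integral_rpow_mul_exp_neg_mul_Ioi hs hC, one_div, Real.inv_rpow hC.le,
    Real.rpow_neg hC.le, mul_comm]

theorem integrable_prod_exp_mul_rpow_mul_exp_cosh {s : ℝ} (hs : 0 < s) :
    Integrable (Function.uncurry fun x u : ℝ =>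
        Real.exp (-x) * x ^ (s - 1) * Real.exp (-x * Real.cosh u))
      ((volume.restrict (Set.Ioi 0)).prod (volume.restrict (Set.Ioi 0))) := by
  refine (integrable_prod_iff' (Measurable.aestronglyMeasurable ?_)).2 ⟨.of_forall fun u => ?_, ?_⟩
  · simp only [Function.uncurry_def]
    fun_prop
  · refine .of_integral_ne_zero ?_
    simp only [Function.uncurry_apply_pair]
    rw [integral_exp_mul_rpow_mul_exp_cosh hs]
    have := Real.Gamma_pos_of_pos hs
    have := Real.cosh_pos u
    positivity
  · refine ((integrableOn_one_add_cosh_rpow_neg hs).const_mul (Real.Gamma s)).congr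
      (.of_forall fun u => ?_)
    simp only [Function.uncurry_apply_pair]
    rw [← integral_exp_mul_rpow_mul_exp_cosh hs]
    refine setIntegral_congr_fun measurableSet_Ioi fun x hx => ?_
    have hx : 0 < x := hx
    exact (Real.norm_of_nonneg (by positivity)).symm

theorem integrableOn_exp_mul_rpow_mul_K0 {s : ℝ} (hs : 0 < s) :
    IntegrableOn (fun x => Real.exp (-x) * x ^ (s - 1) * K0 x) (Set.Ioi 0) := by
  have h := (integrable_prod_exp_mul_rpow_mul_exp_cosh hs).integral_prod_left
  simpa only [IntegrableOn, K0, Function.uncurry_apply_pair, integral_const_mul] using h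

theorem integral_exp_mul_rpow_mul_K0 {s : ℝ} (hs : 0 < s) :
    ∫ x in Set.Ioi (0 : ℝ), Real.exp (-x) * x ^ (s - 1) * K0 x =
      Real.sqrt Real.pi * Real.Gamma s ^ 2 / (2 ^ s * Real.Gamma (s + 1 / 2)) := by
  simp_rw [K0, ← integral_const_mul]
  rw [integral_integral_swap (integrable_prod_exp_mul_rpow_mul_exp_cosh hs)]
  simp_rw [integral_exp_mul_rpow_mul_exp_cosh hs]
  rw [integral_const_mul, integral_one_add_cosh_rpow_neg hs]
  ring

theorem K0_pos {x : ℝ} (hx : 0 < x) : 0 < K0 x := by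
  have hint : IntegrableOn (fun u => Real.exp (-x * Real.cosh u)) (Set.Ioi 0) := by
    refine (exp_neg_integrableOn_Ioi 0 hx).mono' (by fun_prop) ?_
    refine ae_restrict_of_forall_mem measurableSet_Ioi fun u hu => ?_
    have hu : 0 < u := hu
    rw [Real.norm_of_nonneg (Real.exp_pos _).le, Real.exp_le_exp, neg_mul, neg_mul, neg_le_neg_iff]
    gcongr
    exact (Real.self_le_sinh_iff.2 hu.le).trans (Real.sinh_lt_cosh u).le
  have hsupp : (Function.support fun u => Real.exp (-x * Real.cosh u)) = Set.univ :=
    Set.eq_univ_of_forall fun u => (Real.exp_pos _).ne'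
  rw [K0, setIntegral_pos_iff_support_of_nonneg_ae (.of_forall fun u => (Real.exp_pos _).le) hint,
    hsupp, Set.univ_inter]
  simp

theorem integrableOn_eval_mul_weight {α : ℝ} (hα : 0 < α) (g : ℝ[X]) :
    IntegrableOn (fun x => g.eval x * Real.exp (-x) * x ^ (α - 1) * K0 x) (Set.Ioi 0) := by
  induction g using Polynomial.induction_on' with
  | add p q hp hq => simpa only [eval_add, add_mul] using! hp.add hq
  | monomial k a =>
    refine IntegrableOn.congr_fun
      ((integrableOn_exp_mul_rpow_mul_K0 (s := α + k) (by positivity)).const_mul a)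
      (fun x hx => ?_) measurableSet_Ioi
    have hx : 0 < x := hx
    simp only [eval_monomial]
    rw [show α + k - 1 = (α - 1) + k by ring, Real.rpow_add_natCast hx.ne']
    ring

/-- Integration of polynomials against the weight `e^{-x} x^{α-1} K₀(x)` on `(0, ∞)`. -/
noncomputable def weightFunctional {α : ℝ} (hα : 0 < α) : ℝ[X] →ₗ[ℝ] ℝ where
  toFun g := ∫ x in Set.Ioi (0 : ℝ), g.eval x * Real.exp (-x) * x ^ (α - 1) * K0 x
  map_add' p q := by
    rw [← integral_add (integrableOn_eval_mul_weight hα p) (integrableOn_eval_mul_weight hα q)]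
    simp only [eval_add, add_mul]
  map_smul' c p := by
    simp only [eval_smul, smul_eq_mul, RingHom.id_apply, mul_assoc, integral_const_mul]

theorem weightFunctional_X_pow {α : ℝ} (hα : 0 < α) (k : ℕ) :
    weightFunctional hα (X ^ k) = Real.sqrt Real.pi * Real.Gamma (α + k) ^ 2 /
      (2 ^ (α + k) * Real.Gamma (α + k + 1 / 2)) := by
  rw [← integral_exp_mul_rpow_mul_K0 (by positivity)]
  refine setIntegral_congr_fun measurableSet_Ioi fun x hx => ?_
  have hx : 0 < x := hx
  simp only [eval_pow, eval_X]
  rw [show α + k - 1 = (α - 1) + k by ring, Real.rpow_add_natCast hx.ne']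
  ring

theorem weightFunctional_pos {α : ℝ} (hα : 0 < α) {g : ℝ[X]} (hg : g ≠ 0)
    (hpos : ∀ x : ℝ, 0 < x → 0 ≤ g.eval x) : 0 < weightFunctional hα g := by
  have hnonneg : ∀ x ∈ Set.Ioi (0 : ℝ),
      0 ≤ g.eval x * Real.exp (-x) * x ^ (α - 1) * K0 x := fun x hx => by
    have hx : 0 < x := hx
    have := hpos x hx
    have := K0_pos hx
    positivity
  refine (setIntegral_pos_iff_support_of_nonneg_ae
    (ae_restrict_of_forall_mem measurableSet_Ioi hnonneg) (integrableOn_eval_mul_weight hα g)).2 ?_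
  have hsub : Set.Ioi (0 : ℝ) \ (g.roots.toFinset : Set ℝ) ⊆
      (Function.support fun x => g.eval x * Real.exp (-x) * x ^ (α - 1) * K0 x) ∩ Set.Ioi 0 := by
    rintro x ⟨hx, hroot⟩
    refine ⟨?_, hx⟩
    have hx : 0 < x := hx
    have hx' : g.eval x ≠ 0 := by simpa [hg] using hroot
    have := K0_pos hx
    rw [Function.mem_support]
    positivity
  refine lt_of_lt_of_le ?_ (measure_mono hsub)
  rw [measure_sdiff_null (Finset.measure_zero _ _)]
  simp

theorem weightFunctional_raisingOp {α : ℝ} (hα : 0 < α) (q : ℝ[X]) :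
    weightFunctional hα (raisingOp α q) = 0 := by
  induction q using Polynomial.induction_on' with
  | add p q hp hq => rw [map_add, map_add, hp, hq, add_zero]
  | monomial k a =>
    rw [← C_mul_X_pow_eq_monomial, ← smul_eq_C_mul, map_smul, raisingOp_X_pow, ← smul_eq_C_mul,
      ← smul_eq_C_mul, map_smul, map_sub, map_smul, map_smul, weightFunctional_X_pow,
      weightFunctional_X_pow]
    have hs : 0 < α + k := by positivity
    have hΓ := Real.Gamma_pos_of_pos (show 0 < α + k + 1 / 2 by positivity)
    rw [show α + ((k + 1 : ℕ) : ℝ) = α + k + 1 by push_cast; ring, Real.Gamma_add_one hs.ne',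
      show α + k + 1 + 1 / 2 = α + k + 1 / 2 + 1 by ring,
      Real.Gamma_add_one (by positivity : α + k + 1 / 2 ≠ 0), Real.rpow_add_one two_ne_zero]
    simp only [smul_eq_mul]
    generalize α + k = s at *
    have h2 : (2 : ℝ) ^ s ≠ 0 := by positivity
    field_simp
    ring

theorem weightFunctional_PmonicR_succ {α : ℝ} (hα : 0 < α) (n : ℕ) :
    weightFunctional hα (PmonicR α (n + 1)) = 0 := by
  rw [PmonicR, map_smul, pseqR_succ, weightFunctional_raisingOp, smul_zero]

theorem stmt19 (α : ℝ) (hα : 0 < α) :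
    (∫ x in Set.Ioi (0 : ℝ), Real.exp (-x) * x ^ (α - 1) * K0 x
        = Real.sqrt Real.pi * Real.Gamma α ^ 2 / (2 ^ α * Real.Gamma (α + 1 / 2)))
    ∧ (∀ n : ℕ, 1 ≤ n →
        ∫ x in Set.Ioi (0 : ℝ), (PmonicR α n).eval x * Real.exp (-x) * x ^ (α - 1) * K0 x = 0)
    ∧ (∀ g : ℝ[X], g ≠ 0 → (∀ x : ℝ, 0 < x → 0 ≤ g.eval x) →
        0 < ∫ x in Set.Ioi (0 : ℝ), g.eval x * Real.exp (-x) * x ^ (α - 1) * K0 x)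
    ∧ (∀ u0 : ℝ[X] →ₗ[ℝ] ℝ, (∀ k : ℕ, u0 (PmonicR α k) = if k = 0 then 1 else 0) →
        ∀ f : ℝ[X],
          u0 f = 2 ^ α * Real.Gamma (α + 1 / 2) / (Real.sqrt Real.pi * Real.Gamma α ^ 2) *
            ∫ x in Set.Ioi (0 : ℝ), f.eval x * Real.exp (-x) * x ^ (α - 1) * K0 x) := by
  refine ⟨integral_exp_mul_rpow_mul_K0 hα, fun n hn => ?_, fun g hg hpos => ?_, fun u0 hu0 f => ?_⟩
  · obtain ⟨m, rfl⟩ := Nat.exists_eq_add_of_le' hn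
    exact weightFunctional_PmonicR_succ hα m
  · exact weightFunctional_pos hα hg hpos
  · set c := 2 ^ α * Real.Gamma (α + 1 / 2) / (Real.sqrt Real.pi * Real.Gamma α ^ 2) with hc
    have hext : u0 = c • weightFunctional hα := linearMap_ext_PmonicR hα fun n => by
      rw [hu0, LinearMap.smul_apply, smul_eq_mul]
      rcases n with _ | n
      · have h0 := weightFunctional_X_pow hα 0
        simp only [pow_zero, Nat.cast_zero, add_zero] at h0
        have hΓ := Real.Gamma_pos_of_pos hα
        have hΓ' := Real.Gamma_pos_of_pos (show 0 < α + 1 / 2 by positivity)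
        have hP : PmonicR α 0 = 1 := by simp [PmonicR, pseqR]
        rw [hP, h0, hc, if_pos rfl]
        field_simp
      · simp [weightFunctional_PmonicR_succ]
    rw [hext]
    rfl
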